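/- Let K ⊂ ℝⁿ be an isotropic convex body with isotropy parameter M_K, and suppose there exist a point X₀ ∈ ∂K and sequences (C_m), (D_m) of Borel sets such that: C_m ∩ int(K) = ∅, |C_m| > 0, |C_m| → 0, K ∪ C_m is a convex body, X₀ lies in the closure of C_m for all m and diam(C_m) → 0; and D_m ⊂ K, |D_m| > 0, |D_m| → 0, K \ D_m is a convex body, X₀ lies in the closure of D_m for all m and diam(D_m) → 0. If K is a local maximizer or a local minimizer for the isotropy constant L (with respect to Hausdorff distance), then |X₀|² |K| = (n+2) M_K². -/

import Mathlib

open MeasureTheory Metric Set Filter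
open scoped InnerProductSpace Topology

noncomputable section

/-- A convex body in ℝⁿ: a compact convex set with nonempty interior. -/
def IsConvexBody {n : ℕ} (K : Set (EuclideanSpace ℝ (Fin n))) : Prop :=
  IsCompact K ∧ Convex ℝ K ∧ (interior K).Nonempty

/-- The centroid of a set. -/
def centroid {n : ℕ} (K : Set (EuclideanSpace ℝ (Fin n))) : EuclideanSpace ℝ (Fin n) :=
  ((volume K).toReal)⁻¹ • ∫ x in K, x

/-- `(1/n!) ∫_{A}⋯∫_{A} det(X₁ − g, …, Xₙ − g)² dX₁ ⋯ dXₙ`. -/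
def detInt {n : ℕ} (A : Set (EuclideanSpace ℝ (Fin n))) (g : EuclideanSpace ℝ (Fin n)) : ℝ :=
  ((n.factorial : ℝ))⁻¹ *
    ∫ X in Set.univ.pi (fun _ : Fin n => A),
      (Matrix.det (Matrix.of fun i j : Fin n => X j i - g i)) ^ 2
      ∂(Measure.pi fun _ : Fin n => volume)

/-- `M_K^{2n}`, the 2n-th power of the isotropy parameter of a convex body. -/
def Mpow2n {n : ℕ} (K : Set (EuclideanSpace ℝ (Fin n))) : ℝ := detInt K (centroid K)

/-- The isotropy constant `L_K = M_K / |K|^{(n+2)/(2n)}` of a convex body. -/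
def isoL (n : ℕ) (K : Set (EuclideanSpace ℝ (Fin n))) : ℝ :=
  (Mpow2n K) ^ ((2 * (n : ℝ)))⁻¹ / (volume K).toReal ^ (((n : ℝ) + 2) / (2 * n))

/-- `K` is isotropic with isotropy parameter `M`. -/
def IsIsotropic {n : ℕ} (K : Set (EuclideanSpace ℝ (Fin n))) (M : ℝ) : Prop :=
  0 < M ∧ (∫ x in K, x) = 0 ∧
    ∀ y : EuclideanSpace ℝ (Fin n), (∫ x in K, (⟪x, y⟫_ℝ) ^ 2) = M ^ 2 * ‖y‖ ^ 2

/-- `(N, q)` witnesses positive generalized Gauss curvature of `K` at `X₀`. -/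
def CurvWitness {n : ℕ} (K : Set (EuclideanSpace ℝ (Fin n))) (X₀ N : EuclideanSpace ℝ (Fin n))
    (q : QuadraticForm ℝ (EuclideanSpace ℝ (Fin n))) : Prop :=
  ‖N‖ = 1 ∧ (∀ x ∈ K, 0 ≤ ⟪x - X₀, N⟫_ℝ) ∧
  (∀ Y : EuclideanSpace ℝ (Fin n), ⟪Y, N⟫_ℝ = 0 → Y ≠ 0 → 0 < q Y) ∧
  ∀ ε > (0 : ℝ), ∃ a > (0 : ℝ), ∀ (Y : EuclideanSpace ℝ (Fin n)) (y : ℝ), ⟪Y, N⟫_ℝ = 0 →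
    X₀ + Y + y • N ∈ frontier K ∩ Metric.ball X₀ a →
    (1 - ε) * q Y ≤ y ∧ y ≤ (1 + ε) * q Y

/-- `K` has positive generalized Gauss curvature at `X₀`. -/
def HasPosGenCurvature {n : ℕ} (K : Set (EuclideanSpace ℝ (Fin n)))
    (X₀ : EuclideanSpace ℝ (Fin n)) : Prop :=
  ∃ N q, CurvWitness K X₀ N q

/-- `K` is a local maximizer for the isotropy constant (Hausdorff distance). -/
def IsLocalMaxIso {n : ℕ} (K : Set (EuclideanSpace ℝ (Fin n))) : Prop :=
  ∃ ε > (0 : ℝ), ∀ K' : Set (EuclideanSpace ℝ (Fin n)), IsConvexBody K' →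
    hausdorffDist K' K < ε → isoL n K' ≤ isoL n K

/-- `K` is a local minimizer for the isotropy constant (Hausdorff distance). -/
def IsLocalMinIso {n : ℕ} (K : Set (EuclideanSpace ℝ (Fin n))) : Prop :=
  ∃ ε > (0 : ℝ), ∀ K' : Set (EuclideanSpace ℝ (Fin n)), IsConvexBody K' →
    hausdorffDist K' K < ε → isoL n K ≤ isoL n K'

/-- `X₀` is a point of local strict convexity of `∂K`. -/
def IsLocalStrictConvexPoint {n : ℕ} (K : Set (EuclideanSpace ℝ (Fin n)))
    (X₀ : EuclideanSpace ℝ (Fin n)) : Prop :=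
  X₀ ∈ frontier K ∧
    ¬ ∃ A B : EuclideanSpace ℝ (Fin n), A ≠ B ∧ segment ℝ A B ⊆ frontier K ∧ X₀ ∈ segment ℝ A B


theorem tendsto_det_one_add_smul_fderiv {n : ℕ} {ι : Type*} {l : Filter ι} {s : ι → ℝ}
    {F : ι → Fin n → Fin n → ℝ} {F₀ : Fin n → Fin n → ℝ}
    (hs : Tendsto s l (𝓝 0)) (hs0 : ∀ᶠ i in l, s i ≠ 0) (hF : Tendsto F l (𝓝 F₀)) :
    Tendsto (fun i => (s i)⁻¹ * ((1 + s i • Matrix.of (F i)).det - 1)) l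
      (𝓝 (fderiv ℝ (fun A : Fin n → Fin n → ℝ => (Matrix.of A).det)
        (Matrix.of.symm 1) F₀)) := by
  have hf : DifferentiableAt ℝ (fun A : Fin n → Fin n → ℝ => (Matrix.of A).det)
      (Matrix.of.symm 1) := by
    simp only [Matrix.det_apply', Matrix.of_apply]
    fun_prop
  have h1 := (hasFDerivWithinAt_univ.2 hf.hasFDerivAt).lim (l := l)
    (c := fun i => (s i)⁻¹) (d := fun i => s i • F i) (v := F₀)
    (by simpa using hs.smul hF) (.of_forall fun _ => mem_univ _)
    (hF.congr' (hs0.mono fun i hi => (inv_smul_smul₀ hi _).symm))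
  rw [Equiv.apply_symm_apply, Matrix.det_one] at h1
  exact h1

/-- First-order expansion of the determinant at the identity along a convergent sequence of
directions. -/
theorem tendsto_det_one_add_smul {n : ℕ} {ι : Type*} {l : Filter ι} {s : ι → ℝ}
    {F : ι → Matrix (Fin n) (Fin n) ℝ} {F₀ : Matrix (Fin n) (Fin n) ℝ}
    (hs : Tendsto s l (𝓝 0)) (hs0 : ∀ i, s i ≠ 0) (hF : Tendsto F l (𝓝 F₀)) :
    Tendsto (fun i => (s i)⁻¹ * ((1 + s i • F i).det - 1)) l (𝓝 F₀.trace) := by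
  have hderiv : ∀ G : Matrix (Fin n) (Fin n) ℝ, fderiv ℝ
      (fun A : Fin n → Fin n → ℝ => (Matrix.of A).det) (Matrix.of.symm 1) (fun a b => G a b) =
      G.trace := by
    intro G
    have ht0 : ∀ᶠ t in 𝓝[≠] (0 : ℝ), t ≠ 0 := self_mem_nhdsWithin
    have h1 := tendsto_det_one_add_smul_fderiv (tendsto_id.mono_left nhdsWithin_le_nhds) ht0
      (tendsto_const_nhds (x := fun a b => G a b))
    have h2 : Tendsto (fun t : ℝ => G.trace +
        ((1 + (Polynomial.X : Polynomial ℝ) • G.map Polynomial.C).det.divX.divX.eval t) * t)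
        (𝓝[≠] (0 : ℝ)) (𝓝 G.trace) := by
      refine Tendsto.mono_left ?_ nhdsWithin_le_nhds
      have : Continuous (fun t : ℝ => G.trace +
        ((1 + (Polynomial.X : Polynomial ℝ) • G.map Polynomial.C).det.divX.divX.eval t) * t) := by
        fun_prop
      simpa using this.tendsto 0
    refine tendsto_nhds_unique (h1.congr' ?_) h2
    filter_upwards [ht0] with t ht
    have h3 : (1 + t • Matrix.of fun a b => G a b).det = (1 + t • G).det := rfl
    rw [id, h3, Matrix.det_one_add_smul]
    field_simp
    ring
  have h1 := tendsto_det_one_add_smul_fderiv hs (.of_forall hs0) hF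
  exact hderiv F₀ ▸ h1

theorem tendsto_one_add_mul_pow {ι : Type*} {l : Filter ι} {s : ι → ℝ} (a : ℝ) (k : ℕ)
    (hs : Tendsto s l (𝓝 0)) (hs0 : ∀ i, s i ≠ 0) :
    Tendsto (fun i => (s i)⁻¹ * ((1 + s i * a) ^ k - 1)) l (𝓝 (k * a)) := by
  have hd : HasDerivAt (fun t : ℝ => (1 + t * a) ^ k) (k * a) 0 := by
    simpa using (((hasDerivAt_id' (0 : ℝ)).mul_const a).const_add 1).fun_pow k
  have := (hasDerivAt_iff_tendsto_slope_zero.1 hd).comp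
    (tendsto_nhdsWithin_iff.2 ⟨hs, .of_forall hs0⟩)
  simpa [Function.comp_def] using this

/-- The Andréief identity for the second moments about `g`. -/
theorem detInt_eq_det {n : ℕ} {A : Set (EuclideanSpace ℝ (Fin n))} (hA : IsCompact A)
    (g : EuclideanSpace ℝ (Fin n)) :
    detInt A g = (Matrix.of fun i j : Fin n => ∫ x in A, (x i - g i) * (x j - g j)).det := by
  have hintegrable : ∀ i j : Fin n, IntegrableOn
      (fun x : EuclideanSpace ℝ (Fin n) => (x i - g i) * (x j - g j)) A := fun i j =>
    (by fun_prop : Continuous fun x : EuclideanSpace ℝ (Fin n) =>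
      (x i - g i) * (x j - g j)).continuousOn.integrableOn_compact hA
  have hfin : IsFiniteMeasure ((volume : Measure (EuclideanSpace ℝ (Fin n))).restrict A) :=
    ⟨by simpa using hA.measure_lt_top⟩
  have hexp : ∀ X : Fin n → EuclideanSpace ℝ (Fin n),
      (Matrix.det (Matrix.of fun i j : Fin n => X j i - g i)) ^ 2 =
      ∑ σ : Equiv.Perm (Fin n), ∑ τ : Equiv.Perm (Fin n),
        ((Equiv.Perm.sign σ : ℤ) : ℝ) * ((Equiv.Perm.sign τ : ℤ) : ℝ) *
          ∏ k, ((X k (σ k) - g (σ k)) * (X k (τ k) - g (τ k))) := by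
    intro X
    rw [sq, Matrix.det_apply', Finset.sum_mul_sum]
    refine Finset.sum_congr rfl fun σ _ => Finset.sum_congr rfl fun τ _ => ?_
    rw [Finset.prod_mul_distrib]
    simp only [Matrix.of_apply]
    ring
  have hprod : ∀ σ τ : Equiv.Perm (Fin n), Integrable
      (fun X : Fin n → EuclideanSpace ℝ (Fin n) =>
        ((Equiv.Perm.sign σ : ℤ) : ℝ) * ((Equiv.Perm.sign τ : ℤ) : ℝ) *
          ∏ k, ((X k (σ k) - g (σ k)) * (X k (τ k) - g (τ k))))
      (Measure.pi fun _ => volume.restrict A) := fun σ τ =>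
    (Integrable.fintype_prod (f := fun k (x : EuclideanSpace ℝ (Fin n)) =>
      (x (σ k) - g (σ k)) * (x (τ k) - g (τ k))) fun k => hintegrable _ _).const_mul _
  unfold detInt
  rw [Measure.restrict_pi_pi]
  simp_rw [hexp]
  rw [integral_finsetSum _ fun σ _ => integrable_finsetSum _ fun τ _ => hprod σ τ]
  simp_rw [integral_finsetSum _ fun τ _ => hprod _ τ, integral_const_mul]
  have hfub : ∀ σ τ : Equiv.Perm (Fin n),
      ∫ X : Fin n → EuclideanSpace ℝ (Fin n),
        ∏ k, ((X k (σ k) - g (σ k)) * (X k (τ k) - g (τ k)))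
        ∂(Measure.pi fun _ => volume.restrict A) =
      ∏ k, ∫ x in A, (x (σ k) - g (σ k)) * (x (τ k) - g (τ k)) := fun σ τ =>
    integral_fintype_prod_eq_prod fun k (x : EuclideanSpace ℝ (Fin n)) =>
      (x (σ k) - g (σ k)) * (x (τ k) - g (τ k))
  simp_rw [hfub]
  set S : Matrix (Fin n) (Fin n) ℝ :=
    Matrix.of fun i j : Fin n => ∫ x in A, (x i - g i) * (x j - g j) with hS
  have hrow : ∀ τ : Equiv.Perm (Fin n), ∑ σ : Equiv.Perm (Fin n),
      ((Equiv.Perm.sign σ : ℤ) : ℝ) * ((Equiv.Perm.sign τ : ℤ) : ℝ) *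
        ∏ k, S (σ k) (τ k) = S.det := by
    intro τ
    have h1 := Matrix.det_permute' τ S
    have h2 : ((Equiv.Perm.sign τ : ℤ) : ℝ) * ((Equiv.Perm.sign τ : ℤ) : ℝ) = 1 := by
      exact_mod_cast Int.units_coe_mul_self _
    calc _ = ((Equiv.Perm.sign τ : ℤ) : ℝ) * (S.submatrix id τ).det := by
          rw [Matrix.det_apply', Finset.mul_sum]
          refine Finset.sum_congr rfl fun σ _ => ?_
          simp only [Matrix.submatrix_apply, id]
          ring
      _ = S.det := by rw [h1, ← mul_assoc, h2, one_mul]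
  have hsum : ∑ σ : Equiv.Perm (Fin n), ∑ τ : Equiv.Perm (Fin n),
      ((Equiv.Perm.sign σ : ℤ) : ℝ) * ((Equiv.Perm.sign τ : ℤ) : ℝ) *
        ∏ k, S (σ k) (τ k) = (n.factorial : ℝ) * S.det := by
    rw [Finset.sum_comm]
    simp_rw [hrow]
    simp [Fintype.card_perm]
  have hsum' := hsum
  simp only [hS, Matrix.of_apply] at hsum'
  rw [hsum', ← mul_assoc, inv_mul_cancel₀ (by positivity), one_mul]

theorem detInt_nonneg {n : ℕ} (A : Set (EuclideanSpace ℝ (Fin n)))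
    (g : EuclideanSpace ℝ (Fin n)) : 0 ≤ detInt A g :=
  mul_nonneg (by positivity) (integral_nonneg fun _ => sq_nonneg _)

theorem volume_real_pos_of_isConvexBody {n : ℕ} {K : Set (EuclideanSpace ℝ (Fin n))}
    (hK : IsConvexBody K) : 0 < (volume K).toReal :=
  ENNReal.toReal_pos (Measure.measure_pos_of_nonempty_interior _ hK.2.2).ne' hK.1.measure_lt_top.ne

theorem isoL_le_isoL_iff {n : ℕ} (hn : 0 < n) {K K' : Set (EuclideanSpace ℝ (Fin n))}
    (hK : IsConvexBody K) (hK' : IsConvexBody K') :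
    isoL n K ≤ isoL n K' ↔ Mpow2n K / (volume K).toReal ^ (n + 2) ≤
      Mpow2n K' / (volume K').toReal ^ (n + 2) := by
  have hn' : (0 : ℝ) < n := Nat.cast_pos.2 hn
  have key : ∀ {A : Set (EuclideanSpace ℝ (Fin n))}, IsConvexBody A →
      isoL n A = (Mpow2n A / (volume A).toReal ^ (n + 2)) ^ ((2 * (n : ℝ)))⁻¹ := by
    intro A hA
    have hV := volume_real_pos_of_isConvexBody hA
    rw [isoL, Real.div_rpow (x := Mpow2n A) (detInt_nonneg _ _) (by positivity), ← Real.rpow_natCast,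
      ← Real.rpow_mul hV.le]
    push_cast
    rw [div_eq_mul_inv ((n : ℝ) + 2)]
  rw [key hK, key hK']
  refine Real.rpow_le_rpow_iff ?_ ?_ (by positivity) <;>
  exact div_nonneg (detInt_nonneg _ _) (by positivity)

theorem integral_euclideanSpace_apply {n : ℕ} {A : Set (EuclideanSpace ℝ (Fin n))}
    (hA : IsCompact A) (i : Fin n) : ∫ x in A, x i = (∫ x in A, x) i :=
  (EuclideanSpace.proj i : EuclideanSpace ℝ (Fin n) →L[ℝ] ℝ).integral_comp_comm
    (continuous_id.continuousOn.integrableOn_compact hA)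

theorem Mpow2n_eq_det {n : ℕ} {A : Set (EuclideanSpace ℝ (Fin n))} (hA : IsConvexBody A) :
    Mpow2n A = (Matrix.of fun i j : Fin n =>
      (∫ x in A, x i * x j) - (∫ x in A, x i) * (∫ x in A, x j) / (volume A).toReal).det := by
  have hV := volume_real_pos_of_isConvexBody hA
  have hintegrable : ∀ f : EuclideanSpace ℝ (Fin n) → ℝ, Continuous f → IntegrableOn f A := fun f hf =>
    hf.continuousOn.integrableOn_compact hA.1
  have hcen : ∀ i, centroid A i = (∫ x in A, x i) / (volume A).toReal := by
    intro i
    rw [centroid, PiLp.smul_apply, integral_euclideanSpace_apply hA.1, smul_eq_mul, div_eq_inv_mul]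
  rw [Mpow2n, detInt_eq_det hA.1]
  congr 1
  ext i j
  simp only [Matrix.of_apply]
  have hexp : ∀ x : EuclideanSpace ℝ (Fin n),
      (x i - centroid A i) * (x j - centroid A j) =
      x i * x j - centroid A j * x i - centroid A i * x j + centroid A i * centroid A j := by
    intro x; ring
  simp_rw [hexp]
  have c1 := hintegrable (fun x => x i * x j) (by fun_prop)
  have c2 := hintegrable (fun x => centroid A j * x i) (by fun_prop)
  have c3 := hintegrable (fun x => centroid A i * x j) (by fun_prop)
  have c4 := hintegrable (fun _ => centroid A i * centroid A j) continuous_const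
  have e1 := integral_add ((c1.sub c2).sub c3) c4
  have e2 := integral_sub (c1.sub c2) c3
  have e3 := integral_sub c1 c2
  simp only [Pi.sub_apply] at e1 e2 e3
  rw [e1, e2, e3, integral_const_mul, integral_const_mul, setIntegral_const, hcen, hcen,
    Measure.real, smul_eq_mul]
  field_simp
  ring

theorem IsIsotropic.integral_mul_eq {n : ℕ} {K : Set (EuclideanSpace ℝ (Fin n))} {M : ℝ}
    (hK : IsCompact K) (h : IsIsotropic K M) (i j : Fin n) :
    ∫ x in K, x i * x j = M ^ 2 * (1 : Matrix (Fin n) (Fin n) ℝ) i j := by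
  have hintegrable : ∀ f : EuclideanSpace ℝ (Fin n) → ℝ, Continuous f → IntegrableOn f K := fun f hf =>
    hf.continuousOn.integrableOn_compact hK
  set u : EuclideanSpace ℝ (Fin n) := EuclideanSpace.single i 1
  set v : EuclideanSpace ℝ (Fin n) := EuclideanSpace.single j 1
  have hu : ∀ x : EuclideanSpace ℝ (Fin n), ⟪x, u⟫_ℝ = x i := fun x => by
    simpa using EuclideanSpace.inner_single_right i (1 : ℝ) x
  have hv : ∀ x : EuclideanSpace ℝ (Fin n), ⟪x, v⟫_ℝ = x j := fun x => by
    simpa using EuclideanSpace.inner_single_right j (1 : ℝ) x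
  have h1 := h.2.2 (u + v)
  have h2 := h.2.2 (u - v)
  have huv : u j = (1 : Matrix (Fin n) (Fin n) ℝ) i j := by
    simp [u, Matrix.one_apply, eq_comm]
  rw [norm_add_sq_real] at h1
  rw [norm_sub_sq_real] at h2
  simp only [inner_add_right, inner_sub_right, hu, hv] at h1 h2
  have h3 : ∫ x in K, x i * x j =
      ((∫ x in K, (x i + x j) ^ 2) - ∫ x in K, (x i - x j) ^ 2) / 4 := by
    rw [← integral_sub (hintegrable _ (by fun_prop)) (hintegrable _ (by fun_prop)), ← integral_div]
    congr 1
    ext x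
    ring
  rw [h3, h1, h2, huv]
  ring

theorem IsIsotropic.integral_apply_eq_zero {n : ℕ} {K : Set (EuclideanSpace ℝ (Fin n))} {M : ℝ}
    (hK : IsCompact K) (h : IsIsotropic K M) (i : Fin n) : ∫ x in K, x i = 0 := by
  rw [integral_euclideanSpace_apply hK, h.2.1, PiLp.zero_apply]

theorem IsIsotropic.Mpow2n_eq {n : ℕ} {K : Set (EuclideanSpace ℝ (Fin n))} {M : ℝ}
    (hK : IsConvexBody K) (h : IsIsotropic K M) : Mpow2n K = (M ^ 2) ^ n := by
  rw [Mpow2n_eq_det hK]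
  simp_rw [h.integral_mul_eq hK.1, h.integral_apply_eq_zero hK.1]
  have : (Matrix.of fun i j : Fin n =>
      M ^ 2 * (1 : Matrix (Fin n) (Fin n) ℝ) i j - 0 * 0 / (volume K).toReal) =
      (M ^ 2) • (1 : Matrix (Fin n) (Fin n) ℝ) := by
    ext i j
    simp
  rw [this, Matrix.det_smul, Matrix.det_one, mul_one, Fintype.card_fin]

/-- Derivative of `M_K^{2n}` and of the volume when mass of signed volume `s i` is added to an
isotropic body with normalized distribution `a i` converging to the Dirac mass at `X₀`. -/
theorem IsIsotropic.tendsto_perturbation {n : ℕ} {K : Set (EuclideanSpace ℝ (Fin n))} {M : ℝ}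
    (hK : IsConvexBody K) (h : IsIsotropic K M) {X₀ : EuclideanSpace ℝ (Fin n)}
    {ι : Type*} {l : Filter ι} {K' : ι → Set (EuclideanSpace ℝ (Fin n))} {s : ι → ℝ}
    {a : ι → (EuclideanSpace ℝ (Fin n) → ℝ) → ℝ}
    (hK' : ∀ i, IsConvexBody (K' i)) (hs : Tendsto s l (𝓝 0)) (hs0 : ∀ i, s i ≠ 0)
    (ha : ∀ f, Continuous f → Tendsto (fun i => a i f) l (𝓝 (f X₀)))
    (hvol : ∀ i, (volume (K' i)).toReal = (volume K).toReal + s i)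
    (hintegrable : ∀ i f, Continuous f → ∫ x in K' i, f x = (∫ x in K, f x) + s i * a i f) :
    Tendsto (fun i => (s i)⁻¹ * (Mpow2n (K' i) / Mpow2n K -
      ((volume (K' i)).toReal / (volume K).toReal) ^ (n + 2))) l
      (𝓝 (‖X₀‖ ^ 2 / M ^ 2 - (n + 2) / (volume K).toReal)) := by
  have hV := volume_real_pos_of_isConvexBody hK
  have hM : 0 < M ^ 2 := pow_pos h.1 2
  let F : ι → Matrix (Fin n) (Fin n) ℝ := fun m => Matrix.of fun i j =>
    (M ^ 2)⁻¹ * (a m (fun x => x i * x j) -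
      s m * (a m (fun x => x i)) * (a m (fun x => x j)) / ((volume K).toReal + s m))
  let F₀ : Matrix (Fin n) (Fin n) ℝ := Matrix.of fun i j => (M ^ 2)⁻¹ * (X₀ i * X₀ j)
  have hF : Tendsto F l (𝓝 F₀) := by
    refine tendsto_pi_nhds.2 fun i => tendsto_pi_nhds.2 fun j => ?_
    have h1 := ha (fun x => x i * x j) (by fun_prop)
    have h2 := ha (fun x => x i) (by fun_prop)
    have h3 := ha (fun x => x j) (by fun_prop)
    have h4 : Tendsto (fun m => (volume K).toReal + s m) l (𝓝 ((volume K).toReal + 0)) :=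
      tendsto_const_nhds.add hs
    have h5 := (h1.sub (((hs.mul h2).mul h3).div h4 (by simpa using hV.ne'))).const_mul (M ^ 2)⁻¹
    simpa [F, F₀] using h5
  have htr : F₀.trace = ‖X₀‖ ^ 2 / M ^ 2 := by
    rw [EuclideanSpace.real_norm_sq_eq]
    simp only [Matrix.trace, Matrix.diag, F₀, Matrix.of_apply]
    rw [← Finset.mul_sum, div_eq_inv_mul]
    congr 1
    exact Finset.sum_congr rfl fun i _ => (sq _).symm
  have hdet : ∀ m, Mpow2n (K' m) / Mpow2n K = (1 + s m • F m).det := by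
    intro m
    have hV' := volume_real_pos_of_isConvexBody (hK' m)
    rw [hvol] at hV'
    have hmat : (Matrix.of fun i j : Fin n => (∫ x in K' m, x i * x j) -
        (∫ x in K' m, x i) * (∫ x in K' m, x j) / (volume (K' m)).toReal) =
        (M ^ 2) • (1 + s m • F m) := by
      ext i j
      simp only [Matrix.of_apply, Matrix.smul_apply, Matrix.add_apply, smul_eq_mul, F]
      rw [hintegrable m _ (by fun_prop), hintegrable m _ (by fun_prop), hintegrable m _ (by fun_prop),
        h.integral_mul_eq hK.1, h.integral_apply_eq_zero hK.1, h.integral_apply_eq_zero hK.1,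
        hvol]
      have hM0 := h.1.ne'
      field_simp
      ring
    rw [Mpow2n_eq_det (hK' m), hmat, h.Mpow2n_eq hK, Matrix.det_smul, Fintype.card_fin]
    field_simp
  have h1 := tendsto_det_one_add_smul hs hs0 hF
  have h2 := tendsto_one_add_mul_pow (volume K).toReal⁻¹ (n + 2) hs hs0
  have h3 := h1.sub h2
  rw [htr] at h3
  push_cast at h3
  rw [div_eq_mul_inv ((n : ℝ) + 2)]
  refine h3.congr fun m => ?_
  rw [hdet, hvol, add_div, div_self hV.ne', div_eq_mul_inv]
  ring

theorem tendsto_setAverage_of_diam {E : Type*} [MetricSpace E] [ProperSpace E] [MeasurableSpace E]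
    [BorelSpace E] {μ : Measure E} [IsFiniteMeasureOnCompacts μ] {X₀ : E} {A : ℕ → Set E}
    (hmeas : ∀ m, MeasurableSet (A m)) (hbdd : ∀ m, Bornology.IsBounded (A m))
    (hpos : ∀ m, 0 < μ (A m)) (hcl : ∀ m, X₀ ∈ closure (A m))
    (hdiam : Tendsto (fun m => Metric.diam (A m)) atTop (𝓝 0))
    {f : E → ℝ} (hf : Continuous f) :
    Tendsto (fun m => ⨍ x in A m, f x ∂μ) atTop (𝓝 (f X₀)) := by
  rw [Metric.tendsto_atTop']
  intro ε hε
  obtain ⟨δ, hδ, hfδ⟩ := Metric.continuous_iff.1 hf X₀ (ε / 2) (half_pos hε)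
  obtain ⟨N, hN⟩ := eventually_atTop.1 (hdiam.eventually_lt_const hδ)
  refine ⟨N, fun m hm => ?_⟩
  have hmem : (⨍ x in A m, f x ∂μ) ∈ closedBall (f X₀) (ε / 2) := by
    refine (convex_closedBall _ _).set_average_mem isClosed_closedBall (hpos m).ne'
      (hbdd m).measure_lt_top.ne ?_ ?_
    · refine (ae_restrict_iff' (hmeas m)).2 (.of_forall fun x hx => ?_)
      refine (hfδ x (lt_of_le_of_lt ?_ (hN m hm.le))).le
      rw [← Metric.diam_closure]
      exact Metric.dist_le_diam_of_mem (hbdd m).closure (subset_closure hx) (hcl m)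
    · exact (hf.continuousOn.integrableOn_compact (hbdd m).isCompact_closure).mono_set
        subset_closure
  exact lt_of_le_of_lt (mem_closedBall.1 hmem) (half_lt_self hε)

theorem hausdorffDist_union_le_diam {E : Type*} [MetricSpace E] {K C : Set E} {X₀ : E}
    (hX₀ : X₀ ∈ K) (hC : Bornology.IsBounded C) (hcl : X₀ ∈ closure C) :
    hausdorffDist (K ∪ C) K ≤ Metric.diam C := by
  refine hausdorffDist_le_of_mem_dist Metric.diam_nonneg ?_ fun x hx =>
    ⟨x, Or.inl hx, by simpa using Metric.diam_nonneg⟩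
  rintro x (hx | hx)
  · exact ⟨x, hx, by simpa using Metric.diam_nonneg⟩
  · refine ⟨X₀, hX₀, ?_⟩
    rw [← Metric.diam_closure]
    exact Metric.dist_le_diam_of_mem hC.closure (subset_closure hx) hcl

/-- Removing a piece of diameter less than `r` from a convex set whose every point has another
point at distance at least `r` moves the set by at most `r`. -/
theorem hausdorffDist_sdiff_le {E : Type*} [NormedAddCommGroup E] [NormedSpace ℝ E]
    {K D : Set E} {r : ℝ} (hr : 0 < r) (hK : Convex ℝ K) (hD : Bornology.IsBounded D)
    (hdiam : Metric.diam D < r) (hfar : ∀ x ∈ K, ∃ p ∈ K, r ≤ dist x p) :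
    hausdorffDist (K \ D) K ≤ r := by
  refine hausdorffDist_le_of_mem_dist hr.le (fun x hx => ⟨x, hx.1, by simpa using hr.le⟩) ?_
  intro x hx
  by_cases hxD : x ∈ D
  · obtain ⟨p, hp, hrp⟩ := hfar x hx
    have hd : 0 < dist x p := hr.trans_le hrp
    set y := AffineMap.lineMap x p (r / dist x p) with hy
    have hxy : dist x y = r := by
      rw [hy, dist_left_lineMap, Real.norm_of_nonneg (by positivity)]
      field_simp
    refine ⟨y, ⟨hK.lineMap_mem hx hp ⟨by positivity, (div_le_one hd).2 hrp⟩, fun hyD => ?_⟩, hxy.le⟩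
    exact absurd (Metric.dist_le_diam_of_mem hD hxD hyD) (by linarith)
  · exact ⟨x, ⟨hx, hxD⟩, by simpa using hr.le⟩

theorem volume_toReal_eq_of_setIntegral_eq {n : ℕ} {K K' : Set (EuclideanSpace ℝ (Fin n))} {c : ℝ}
    (h : ∫ _ in K', (1 : ℝ) = (∫ _ in K, (1 : ℝ)) + c) :
    (volume K').toReal = (volume K).toReal + c := by
  simpa [Measure.real, Function.comp_def] using h

theorem IsConvexBody.setIntegral_union {n : ℕ} {K C : Set (EuclideanSpace ℝ (Fin n))}
    (hK : IsConvexBody K) (hmeas : MeasurableSet C) (hdisj : C ∩ interior K = ∅)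
    (hKC : IsConvexBody (K ∪ C)) {f : EuclideanSpace ℝ (Fin n) → ℝ} (hf : Continuous f) :
    ∫ x in K ∪ C, f x = (∫ x in K, f x) + ∫ x in C, f x := by
  have hintegrable := hf.continuousOn.integrableOn_compact (μ := volume) hKC.1
  refine setIntegral_union₀ ?_ hmeas.nullMeasurableSet (hintegrable.mono_set subset_union_left)
    (hintegrable.mono_set subset_union_right)
  refine measure_mono_null ?_ (hK.2.1.addHaar_frontier volume)
  rw [hK.1.isClosed.frontier_eq]
  exact fun x hx => ⟨hx.1, fun hxi => hdisj.subset ⟨hx.2, hxi⟩⟩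

/-- In positive dimension, every point of a convex body is uniformly far from another one. -/
theorem IsConvexBody.exists_le_dist {n : ℕ} (hn : 0 < n) {K : Set (EuclideanSpace ℝ (Fin n))}
    (hK : IsConvexBody K) : ∃ r > 0, ∀ x ∈ K, ∃ p ∈ K, r ≤ dist x p := by
  have : Nonempty (Fin n) := ⟨⟨0, hn⟩⟩
  have hK2 : K.Nontrivial := by
    by_contra h
    have h0 := (Set.not_nontrivial_iff.1 h).measure_zero
      (volume : Measure (EuclideanSpace ℝ (Fin n)))
    have := volume_real_pos_of_isConvexBody hK
    simp [h0] at this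
  obtain ⟨u, hu, v, hv, huv⟩ := hK2
  refine ⟨dist u v / 2, half_pos (dist_pos.2 huv), fun x _ => ?_⟩
  by_contra! h
  linarith [h u hu, h v hv, dist_triangle_left u v x]

theorem ratio_sub_nonpos_iff {n : ℕ} (hn : 0 < n) {K K' : Set (EuclideanSpace ℝ (Fin n))}
    (hK : IsConvexBody K) (hK' : IsConvexBody K') (hpos : 0 < Mpow2n K) :
    Mpow2n K' / Mpow2n K - ((volume K').toReal / (volume K).toReal) ^ (n + 2) ≤ 0 ↔
      isoL n K' ≤ isoL n K := by
  have hV := volume_real_pos_of_isConvexBody hK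
  have hV' := volume_real_pos_of_isConvexBody hK'
  rw [isoL_le_isoL_iff hn hK' hK, sub_nonpos, div_pow, div_le_div_iff₀ hpos (by positivity),
    div_le_div_iff₀ (by positivity) (by positivity), mul_comm (Mpow2n K)]

theorem nonneg_ratio_sub_iff {n : ℕ} (hn : 0 < n) {K K' : Set (EuclideanSpace ℝ (Fin n))}
    (hK : IsConvexBody K) (hK' : IsConvexBody K') (hpos : 0 < Mpow2n K) :
    0 ≤ Mpow2n K' / Mpow2n K - ((volume K').toReal / (volume K).toReal) ^ (n + 2) ↔
      isoL n K ≤ isoL n K' := by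
  have hV := volume_real_pos_of_isConvexBody hK
  have hV' := volume_real_pos_of_isConvexBody hK'
  rw [isoL_le_isoL_iff hn hK hK', sub_nonneg, div_pow, div_le_div_iff₀ (by positivity) hpos,
    div_le_div_iff₀ (by positivity) (by positivity), mul_comm (Mpow2n K)]

/-- **Lemma 5 (Meyer–Reisner).** If `K` is an isotropic convex body which is a local
maximizer or local minimizer for the isotropy constant, and a boundary point `X₀` is
approachable by admissible outer sets `C_m` and inner sets `D_m` of vanishing diameter,
then `|X₀|² |K| = (n+2) M_K²`. -/
theorem norm_sq_eq_of_local_extremizer {n : ℕ} (K : Set (EuclideanSpace ℝ (Fin n))) (M : ℝ)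
    (hK : IsConvexBody K) (hiso : IsIsotropic K M)
    (X₀ : EuclideanSpace ℝ (Fin n)) (hX₀ : X₀ ∈ frontier K)
    (C D : ℕ → Set (EuclideanSpace ℝ (Fin n)))
    (hCmeas : ∀ m, MeasurableSet (C m))
    (hCdisj : ∀ m, C m ∩ interior K = ∅)
    (hCpos : ∀ m, 0 < volume (C m))
    (hCto0 : Tendsto (fun m => volume (C m)) atTop (𝓝 0))
    (hCconv : ∀ m, IsConvexBody (K ∪ C m))
    (hCcl : ∀ m, X₀ ∈ closure (C m))
    (hCdiam : Tendsto (fun m => Metric.diam (C m)) atTop (𝓝 0))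
    (hDmeas : ∀ m, MeasurableSet (D m))
    (hDsub : ∀ m, D m ⊆ K)
    (hDpos : ∀ m, 0 < volume (D m))
    (hDto0 : Tendsto (fun m => volume (D m)) atTop (𝓝 0))
    (hDconv : ∀ m, IsConvexBody (K \ D m))
    (hDcl : ∀ m, X₀ ∈ closure (D m))
    (hDdiam : Tendsto (fun m => Metric.diam (D m)) atTop (𝓝 0))
    (hext : IsLocalMaxIso K ∨ IsLocalMinIso K) :
    ‖X₀‖ ^ 2 * (volume K).toReal = ((n : ℝ) + 2) * M ^ 2 := by

  have hn : 0 < n := by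
    rcases Nat.eq_zero_or_pos n with rfl | h
    · have hu : K = univ := Subsingleton.eq_univ_of_nonempty (hK.2.2.mono interior_subset)
      simp [hu] at hX₀
    · exact h
  have hV := volume_real_pos_of_isConvexBody hK
  have hM : 0 < M ^ 2 := pow_pos hiso.1 2
  have hpos : 0 < Mpow2n K := by
    rw [hiso.Mpow2n_eq hK]
    positivity
  have hXK : X₀ ∈ K := hK.1.isClosed.frontier_subset hX₀
  have hCbdd : ∀ m, Bornology.IsBounded (C m) := fun m =>
    (hCconv m).1.isBounded.subset subset_union_right
  have hDbdd : ∀ m, Bornology.IsBounded (D m) := fun m => hK.1.isBounded.subset (hDsub m)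
  have hCs : ∀ m, 0 < volume.real (C m) := fun m =>
    ENNReal.toReal_pos (hCpos m).ne' (hCbdd m).measure_lt_top.ne
  have hDs : ∀ m, 0 < volume.real (D m) := fun m =>
    ENNReal.toReal_pos (hDpos m).ne' (hDbdd m).measure_lt_top.ne
  have hCint : ∀ m f, Continuous f →
      ∫ x in K ∪ C m, f x = (∫ x in K, f x) + volume.real (C m) * ⨍ x in C m, f x := by
    intro m f hf
    rw [hK.setIntegral_union (hCmeas m) (hCdisj m) (hCconv m) hf, ← smul_eq_mul,
      measure_smul_setAverage f (hCbdd m).measure_lt_top.ne]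
  have hDint : ∀ m f, Continuous f →
      ∫ x in K \ D m, f x = (∫ x in K, f x) + -volume.real (D m) * ⨍ x in D m, f x := by
    intro m f hf
    rw [setIntegral_sdiff (hDmeas m) (hf.continuousOn.integrableOn_compact hK.1) (hDsub m),
      neg_mul, ← smul_eq_mul, measure_smul_setAverage f (hDbdd m).measure_lt_top.ne,
      sub_eq_add_neg]
  have hCvol : ∀ m, (volume (K ∪ C m)).toReal = (volume K).toReal + volume.real (C m) := by
    intro m
    refine volume_toReal_eq_of_setIntegral_eq ?_
    rw [hCint m _ continuous_const, setAverage_const (hCpos m).ne' (hCbdd m).measure_lt_top.ne,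
      mul_one]
  have hDvol : ∀ m, (volume (K \ D m)).toReal = (volume K).toReal + -volume.real (D m) := by
    intro m
    refine volume_toReal_eq_of_setIntegral_eq ?_
    rw [hDint m _ continuous_const, setAverage_const (hDpos m).ne' (hDbdd m).measure_lt_top.ne,
      mul_one]
  have hClim := hiso.tendsto_perturbation hK hCconv
    (by simpa [Measure.real, Function.comp_def] using
      (ENNReal.tendsto_toReal ENNReal.zero_ne_top).comp hCto0)
    (fun m => (hCs m).ne')
    (fun f hf => tendsto_setAverage_of_diam (μ := volume) hCmeas hCbdd hCpos hCcl hCdiam hf)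
    hCvol hCint
  have hDlim := hiso.tendsto_perturbation hK hDconv
    (by simpa [Measure.real, Function.comp_def] using
      ((ENNReal.tendsto_toReal ENNReal.zero_ne_top).comp hDto0).neg)
    (fun m => (neg_neg_of_pos (hDs m)).ne)
    (fun f hf => tendsto_setAverage_of_diam (μ := volume) hDmeas hDbdd hDpos hDcl hDdiam hf)
    hDvol hDint
  have hCnear : ∀ ε > 0, ∀ᶠ m in atTop, hausdorffDist (K ∪ C m) K < ε := by
    intro ε hε
    filter_upwards [hCdiam.eventually_lt_const hε] with m hm
    exact (hausdorffDist_union_le_diam hXK (hCbdd m) (hCcl m)).trans_lt hm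
  have hDnear : ∀ ε > 0, ∀ᶠ m in atTop, hausdorffDist (K \ D m) K < ε := by
    intro ε hε
    obtain ⟨r, hr, hfar⟩ := hK.exists_le_dist hn
    have hr' : 0 < min (ε / 2) r := lt_min (half_pos hε) hr
    filter_upwards [hDdiam.eventually_lt_const hr'] with m hm
    refine (hausdorffDist_sdiff_le hr' hK.2.1 (hDbdd m) hm fun x hx => ?_).trans_lt
      ((min_le_left _ _).trans_lt (half_lt_self hε))
    obtain ⟨p, hp, hxp⟩ := hfar x hx
    exact ⟨p, hp, (min_le_right _ _).trans hxp⟩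
  have hzero : ‖X₀‖ ^ 2 / M ^ 2 - (n + 2) / (volume K).toReal = 0 := by
    rcases hext with ⟨ε, hε, hmax⟩ | ⟨ε, hε, hmin⟩
    · refine le_antisymm (le_of_tendsto hClim ?_) (ge_of_tendsto hDlim ?_)
      · filter_upwards [hCnear ε hε] with m hm
        exact mul_nonpos_of_nonneg_of_nonpos (inv_nonneg.2 (hCs m).le)
          ((ratio_sub_nonpos_iff hn hK (hCconv m) hpos).2 (hmax _ (hCconv m) hm))
      · filter_upwards [hDnear ε hε] with m hm
        exact mul_nonneg_of_nonpos_of_nonpos (inv_nonpos.2 (neg_nonpos.2 (hDs m).le))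
          ((ratio_sub_nonpos_iff hn hK (hDconv m) hpos).2 (hmax _ (hDconv m) hm))
    · refine le_antisymm (le_of_tendsto hDlim ?_) (ge_of_tendsto hClim ?_)
      · filter_upwards [hDnear ε hε] with m hm
        exact mul_nonpos_of_nonpos_of_nonneg (inv_nonpos.2 (neg_nonpos.2 (hDs m).le))
          ((nonneg_ratio_sub_iff hn hK (hDconv m) hpos).2 (hmin _ (hDconv m) hm))
      · filter_upwards [hCnear ε hε] with m hm
        exact mul_nonneg (inv_nonneg.2 (hCs m).le)
          ((nonneg_ratio_sub_iff hn hK (hCconv m) hpos).2 (hmin _ (hCconv m) hm))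
  rwa [sub_eq_zero, div_eq_div_iff hM.ne' hV.ne'] at hzero
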